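/- arXiv:2112.00496 — 3 statements merged into one kernel-verified Lean document; each statement's English description precedes it below -/
import Mathlib

section
/- Let c > 0, x > 0, and let Ψ : ℝ → ℝ be differentiable on the interval [0,x] with Ψ(s) > 0 for all s ∈ [0,x]. If Ψ'(s)·(s + c) > Ψ(s) for all s ∈ [0,x], then Ψ(x)·c > Ψ(0)·(x + c); equivalently, x < (Ψ(x)/Ψ(0) − 1)·c, i.e., 1/x > t where t := [(Ψ(x)/Ψ(0) − 1)·c]^{-1}. -/
/-- Let `c > 0`, `x > 0`, and `Ψ` be differentiable on `[0,x]` with `Ψ > 0` there.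
If `Ψ'(s)·(s + c) > Ψ(s)` for all `s ∈ [0,x]`, then `Ψ(x)·c > Ψ(0)·(x + c)`;
equivalently `x < (Ψ(x)/Ψ(0) − 1)·c`, i.e. `1/x > t` for
`t = [(Ψ(x)/Ψ(0) − 1)·c]⁻¹`. -/
theorem threshold_inequality_of_deriv_gt (c x : ℝ) (hc : 0 < c) (hx : 0 < x)
    (Ψ Ψ' : ℝ → ℝ)
    (hdiff : ∀ s ∈ Set.Icc (0 : ℝ) x, HasDerivAt Ψ (Ψ' s) s)
    (hpos : ∀ s ∈ Set.Icc (0 : ℝ) x, 0 < Ψ s)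
    (hderiv : ∀ s ∈ Set.Icc (0 : ℝ) x, Ψ s < Ψ' s * (s + c)) :
    Ψ 0 * (x + c) < Ψ x * c ∧
    x < (Ψ x / Ψ 0 - 1) * c ∧
    ((Ψ x / Ψ 0 - 1) * c)⁻¹ < 1 / x := by
  have hne : ∀ s ∈ Set.Icc (0 : ℝ) x, s + c ≠ 0 := fun s hs => by linarith [hs.1]
  have hquot : ∀ s ∈ Set.Icc (0 : ℝ) x, HasDerivAt (fun s => Ψ s / (s + c))
      ((Ψ' s * (s + c) - Ψ s * 1) / (s + c) ^ 2) s := fun s hs =>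
    (hdiff s hs).fun_div ((hasDerivAt_id' s).add_const c) (hne s hs)
  have hlt : Ψ 0 / (0 + c) < Ψ x / (x + c) := by
    obtain ⟨s, hs, hslope⟩ := exists_hasDerivAt_eq_slope (fun s => Ψ s / (s + c)) _ hx
      (fun s hs => (hquot s hs).continuousAt.continuousWithinAt)
      (fun s hs => hquot s (Set.Ioo_subset_Icc_self hs))
    have hs' := Set.Ioo_subset_Icc_self hs
    have hslope_pos : 0 < (Ψ' s * (s + c) - Ψ s * 1) / (s + c) ^ 2 :=
      div_pos (by linarith [hderiv s hs']) (sq_pos_of_ne_zero (hne s hs'))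
    rw [hslope, sub_zero, div_pos_iff_of_pos_right hx] at hslope_pos
    exact sub_pos.mp hslope_pos
  rw [zero_add, div_lt_div_iff₀ hc (by positivity)] at hlt
  have h0 : 0 < Ψ 0 := hpos 0 ⟨le_rfl, hx.le⟩
  have hthreshold : x < (Ψ x / Ψ 0 - 1) * c := by
    have heq : (Ψ x / Ψ 0 - 1) * c = (Ψ x * c - Ψ 0 * c) / Ψ 0 := by field_simp
    rw [heq, lt_div_iff₀ h0]
    linarith
  refine ⟨hlt, hthreshold, ?_⟩
  rw [one_div]
  exact inv_strictAnti₀ hx hthreshold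
end

section
/- Let c > 0, x > 0, and let Ψ : ℝ → ℝ be differentiable on the interval [0,x] with Ψ(s) > 0 for all s ∈ [0,x]. If Ψ'(s)·(s + c) ≤ Ψ(s) for all s ∈ [0,x], then Ψ(x)·c ≤ Ψ(0)·(x + c); equivalently, x ≥ (Ψ(x)/Ψ(0) − 1)·c. -/
/-- Let `c > 0`, `x > 0`, and `Ψ` be differentiable on `[0,x]` with `Ψ > 0` there.
If `Ψ'(s)·(s + c) ≤ Ψ(s)` for all `s ∈ [0,x]`, then `Ψ(x)·c ≤ Ψ(0)·(x + c)`;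
equivalently `x ≥ (Ψ(x)/Ψ(0) − 1)·c`. -/
theorem threshold_inequality_of_deriv_le (c x : ℝ) (hc : 0 < c) (hx : 0 < x)
    (Ψ Ψ' : ℝ → ℝ)
    (hdiff : ∀ s ∈ Set.Icc (0 : ℝ) x, HasDerivAt Ψ (Ψ' s) s)
    (hpos : ∀ s ∈ Set.Icc (0 : ℝ) x, 0 < Ψ s)
    (hderiv : ∀ s ∈ Set.Icc (0 : ℝ) x, Ψ' s * (s + c) ≤ Ψ s) :
    Ψ x * c ≤ Ψ 0 * (x + c) ∧ (Ψ x / Ψ 0 - 1) * c ≤ x := by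
  have hadd : ∀ s ∈ Set.Icc (0 : ℝ) x, 0 < s + c := fun s hs => by linarith [hs.1]
  have hquot : ∀ s ∈ Set.Icc (0 : ℝ) x, HasDerivAt (fun t => Ψ t / (t + c))
      ((Ψ' s * (s + c) - Ψ s * 1) / (s + c) ^ 2) s := fun s hs =>
    (hdiff s hs).div ((hasDerivAt_id s).add_const c) (hadd s hs).ne'
  have hanti : AntitoneOn (fun t => Ψ t / (t + c)) (Set.Icc 0 x) := by
    refine antitoneOn_of_deriv_nonpos (convex_Icc 0 x)
      (fun s hs => (hquot s hs).continuousAt.continuousWithinAt)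
      (fun s hs => (hquot s (interior_subset hs)).differentiableAt.differentiableWithinAt)
      (fun s hs => ?_)
    have hs := interior_subset hs
    rw [(hquot s hs).deriv]
    exact div_nonpos_of_nonpos_of_nonneg (by linarith [hderiv s hs]) (sq_nonneg _)
  have h0 : (0 : ℝ) ∈ Set.Icc 0 x := Set.left_mem_Icc.2 hx.le
  have hle : Ψ x / (x + c) ≤ Ψ 0 / (0 + c) := hanti h0 (Set.right_mem_Icc.2 hx.le) hx.le
  rw [zero_add, div_le_div_iff₀ (by positivity) hc] at hle
  refine ⟨hle, ?_⟩
  have hratio : Ψ x / Ψ 0 * c ≤ x + c := by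
    rw [div_mul_eq_mul_div, div_le_iff₀ (hpos 0 h0)]
    linarith
  linarith
end

section
/- (Theorem 1, decreasing branch.) Let P ∈ (0,1), set c := P^{-1} − 1, let 0 < u₂ < u₁, and let Ψ : ℝ → ℝ be differentiable on [u₂,u₁] with Ψ(s) > 0 for all s ∈ [u₂,u₁]. If Ψ'(s)·(s + c) < Ψ(s) for all s ∈ [u₂,u₁], then Ψ(u₁)/(P·u₁ + (1−P)) < Ψ(u₂)/(P·u₂ + (1−P)). In other words, if φ₁(I^pre) = 1/u₁ < 1/u₂ = φ₂(I^pre) and the derivative condition holds on the intermediate range, then φ₁(I^eval) < φ₂(I^eval). -/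
/-- Theorem 1, decreasing branch. Let `P ∈ (0,1)`, `c = P⁻¹ − 1`, `0 < u₂ < u₁`, and
`Ψ` differentiable and positive on `[u₂,u₁]`. If `Ψ'(s)·(s + c) < Ψ(s)` for all
`s ∈ [u₂,u₁]`, then `Ψ(u₁)/(P·u₁ + (1−P)) < Ψ(u₂)/(P·u₂ + (1−P))`; i.e. if
`φ₁(I^pre) = 1/u₁ < 1/u₂ = φ₂(I^pre)` then `φ₁(I^eval) < φ₂(I^eval)`. -/
theorem theorem1_decreasing_branch (P c u₁ u₂ : ℝ) (Ψ Ψ' : ℝ → ℝ)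
    (hP₀ : 0 < P) (hP₁ : P < 1) (hc : c = P⁻¹ - 1)
    (hu₂ : 0 < u₂) (hu : u₂ < u₁)
    (hdiff : ∀ s ∈ Set.Icc u₂ u₁, HasDerivAt Ψ (Ψ' s) s)
    (hpos : ∀ s ∈ Set.Icc u₂ u₁, 0 < Ψ s)
    (hderiv : ∀ s ∈ Set.Icc u₂ u₁, Ψ' s * (s + c) < Ψ s) :
    Ψ u₁ / (P * u₁ + (1 - P)) < Ψ u₂ / (P * u₂ + (1 - P)) := by
  have hden : ∀ s ∈ Set.Icc u₂ u₁, 0 < P * s + (1 - P) := fun s hs => by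
    have := mul_pos hP₀ (hu₂.trans_le hs.1)
    linarith
  have hquot : ∀ s ∈ Set.Icc u₂ u₁, HasDerivAt (fun s => Ψ s / (P * s + (1 - P)))
      ((Ψ' s * (P * s + (1 - P)) - Ψ s * P) / (P * s + (1 - P)) ^ 2) s := fun s hs => by
    have hlin : HasDerivAt (fun s : ℝ => P * s + (1 - P)) P s := by
      simpa using ((hasDerivAt_id s).const_mul P).add_const (1 - P)
    exact (hdiff s hs).fun_div hlin (hden s hs).ne'
  have hanti : StrictAntiOn (fun s => Ψ s / (P * s + (1 - P))) (Set.Icc u₂ u₁) := by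
    refine strictAntiOn_of_deriv_neg (convex_Icc u₂ u₁)
      (fun s hs => (hquot s hs).continuousAt.continuousWithinAt) fun s hs => ?_
    replace hs := interior_subset hs
    rw [(hquot s hs).deriv]
    refine div_neg_of_neg_of_pos ?_ (pow_pos (hden s hs) 2)
    have hscale : P * (s + c) = P * s + (1 - P) := by
      rw [hc]
      field_simp
    have := mul_lt_mul_of_pos_left (hderiv s hs) hP₀
    rw [← hscale]
    linarith
  exact hanti (Set.left_mem_Icc.2 hu.le) (Set.right_mem_Icc.2 hu.le) hu
end
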